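/- arXiv:1409.6071 — 2 statements merged into one kernel-verified Lean document; each statement's English description precedes it below -/
import Mathlib

section
/- Suppose P ∈ ℂ[L,M] is irreducible and P(−L,M) ≠ P(L,M). Let Q ∈ ℂ[L,M] be the unique polynomial satisfying Q(L²,M) = P(L,M)·P(−L,M). Then Q is irreducible in ℂ[L,M] and the L-degree of Q equals the L-degree of P. -/
open Polynomial

section

variable {R : Type*} [CommRing R]

theorem comp_X_sq_comp_neg_X (P : R[X]) : (P.comp (X ^ 2)).comp (-X) = P.comp (X ^ 2) := by
  simp [comp_assoc]

theorem comp_neg_X_dvd_comp_X_sq {P A : R[X]} (h : P ∣ A.comp (X ^ 2)) :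
    P.comp (-X) ∣ A.comp (X ^ 2) := by
  obtain ⟨D, hD⟩ := h
  exact ⟨D.comp (-X), by rw [← mul_comp, ← hD, comp_X_sq_comp_neg_X]⟩

theorem comp_X_sq_injective : Function.Injective fun P : R[X] => P.comp (X ^ 2) := by
  intro P Q h
  apply expand_injective (R := R) (n := 2) two_pos
  simpa only [expand_eq_comp_X_pow] using h

variable [IsDomain R]

theorem isUnit_of_isUnit_comp_X_sq {B : R[X]} (h : IsUnit (B.comp (X ^ 2))) : IsUnit B := by
  obtain ⟨r, hr, hB⟩ := isUnit_iff.mp h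
  have : B = C r := comp_X_sq_injective (by simp [← hB])
  exact this ▸ hr.map C

/-- If `P` and `P(-X)` are distinct but associated, then `P(-X) = -P`. -/
theorem comp_neg_X_eq_neg_of_dvd {P : R[X]} (hP : Irreducible P) (hne : P.comp (-X) ≠ P)
    (h : P ∣ P.comp (-X)) : P.comp (-X) = -P := by
  obtain ⟨c, hc⟩ := h
  have hcc : c * c.comp (-X) = 1 := by
    have := comp_neg_X_comp_neg_X P
    rw [hc, mul_comp, hc, mul_assoc] at this
    exact mul_left_cancel₀ hP.ne_zero (by rw [this, mul_one])
  obtain ⟨r, -, rfl⟩ := isUnit_iff.mp (IsUnit.of_mul_eq_one _ hcc)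
  rw [C_comp] at hcc
  rcases mul_self_eq_one_iff.mp hcc with h1 | h1
  · exact absurd (by rw [hc, h1, mul_one]) hne
  · rw [hc, h1, mul_neg_one]

/-- An irreducible odd polynomial is associated to `X`. -/
theorem exists_eq_X_mul_C_of_comp_neg_X_eq_neg {P : R[X]} (h2 : (2 : R) ≠ 0)
    (hP : Irreducible P) (h : P.comp (-X) = -P) : ∃ r : R, IsUnit r ∧ P = X * C r := by
  have h0 : P.eval 0 = 0 := by
    have := congrArg (eval 0) h
    simp only [eval_comp, eval_neg, eval_X, neg_zero] at this
    have : 2 * P.eval 0 = 0 := by linear_combination this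
    exact (mul_eq_zero.mp this).resolve_left h2
  obtain ⟨u, hu⟩ : X ∣ P := by rwa [X_dvd_iff, coeff_zero_eq_eval_zero]
  obtain ⟨r, hr, rfl⟩ := isUnit_iff.mp ((hP.isUnit_or_isUnit hu).resolve_left not_isUnit_X)
  exact ⟨r, hr, hu⟩

theorem natDegree_eq_of_comp_X_sq_eq {P Q : R[X]} (hQ : Q.comp (X ^ 2) = P * P.comp (-X)) :
    Q.natDegree = P.natDegree := by
  by_cases hP : P = 0
  · have : Q = 0 := comp_X_sq_injective (by simp [hQ, hP])
    rw [this, hP]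
  have hP' : P.comp (-X) ≠ 0 := fun h => hP (by simpa [h] using (comp_neg_X_comp_neg_X P).symm)
  have := congrArg natDegree hQ
  rw [natDegree_mul hP hP', natDegree_comp, natDegree_comp, natDegree_neg, natDegree_X,
    natDegree_X_pow] at this
  lia

theorem isUnit_of_dvd_comp_X_sq {P A B : R[X]} (hP : Prime P) (hndvd : ¬ P ∣ P.comp (-X))
    (hAB : A.comp (X ^ 2) * B.comp (X ^ 2) = P * P.comp (-X)) (h : P ∣ A.comp (X ^ 2)) :
    IsUnit B := by
  have h' := comp_neg_X_dvd_comp_X_sq h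
  obtain ⟨D, hD⟩ := h'
  have hPD : P ∣ D := (hP.dvd_or_dvd (hD ▸ h)).resolve_left hndvd
  obtain ⟨E, rfl⟩ := hPD
  have hP' : P.comp (-X) ≠ 0 := fun h0 => hndvd (h0 ▸ dvd_zero P)
  refine isUnit_of_isUnit_comp_X_sq (IsUnit.of_mul_eq_one E ?_)
  refine mul_left_cancel₀ (mul_ne_zero hP.ne_zero hP') ?_
  rw [hD] at hAB
  linear_combination hAB

theorem irreducible_of_comp_X_sq_eq [DecompositionMonoid R[X]] {P Q : R[X]} (h2 : (2 : R) ≠ 0)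
    (hP : Irreducible P) (hne : P.comp (-X) ≠ P)
    (hQ : Q.comp (X ^ 2) = P * P.comp (-X)) : Irreducible Q := by
  by_cases hdvd : P ∣ P.comp (-X)
  · have hodd := comp_neg_X_eq_neg_of_dvd hP hne hdvd
    obtain ⟨r, hr, rfl⟩ := exists_eq_X_mul_C_of_comp_neg_X_eq_neg h2 hP hodd
    have hQX : Q = C (-(r * r)) * X := by
      apply comp_X_sq_injective
      simp only [hQ, hodd, mul_comp, C_comp, X_comp]
      rw [C_neg, C_mul]
      ring
    rw [hQX, irreducible_isUnit_mul ((hr.mul hr).neg.map C)]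
    exact irreducible_X
  · refine ⟨fun hu => hP.not_isUnit ?_, fun A B hAB => ?_⟩
    · refine isUnit_of_mul_isUnit_left (y := P.comp (-X)) ?_
      rw [← hQ]
      exact hu.map (compRingHom (X ^ 2))
    · rw [hAB, mul_comp] at hQ
      rcases hP.prime.dvd_or_dvd (hQ ▸ dvd_mul_right P _) with h | h
      · exact Or.inr (isUnit_of_dvd_comp_X_sq hP.prime hdvd hQ h)
      · exact Or.inl (isUnit_of_dvd_comp_X_sq hP.prime hdvd (by rw [mul_comm, hQ]) h)

end

/-- Identify `ℂ[L,M]` with `Polynomial (Polynomial ℂ)`, where the outer variable is `L`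
and the inner variable is `M`.  If `P` is irreducible with `P(−L,M) ≠ P(L,M)`, and
`Q(L²,M) = P(L,M)·P(−L,M)`, then `Q` is irreducible and its `L`-degree equals that of `P`. -/
theorem irreducible_res_sq (P Q : Polynomial (Polynomial ℂ))
    (hP : Irreducible P) (hne : P.comp (-X) ≠ P)
    (hQ : Q.comp (X ^ 2) = P * P.comp (-X)) :
    Irreducible Q ∧ Q.natDegree = P.natDegree := by
  exact ⟨irreducible_of_comp_X_sq_eq two_ne_zero hP hne hQ, natDegree_eq_of_comp_X_sq_eq hQ⟩
end

section
/- Suppose Q ∈ ℂ[L,M] is irreducible. If the polynomial Q(L,M²) (the image of Q under the ℂ-algebra homomorphism L ↦ L, M ↦ M²) is not irreducible in ℂ[L,M], then there exist a polynomial S ∈ ℂ[L,M] and a nonzero constant c ∈ ℂ such that Q(L,M²) = c·S(L,M)·S(L,−M). -/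
open Polynomial

/-- The image of `Q ∈ ℂ[L,M]` under the `ℂ`-algebra homomorphism `L ↦ L`, `M ↦ M²`,
where `ℂ[L,M]` is identified with `Polynomial (Polynomial ℂ)` (outer variable `L`,
inner variable `M`). -/
noncomputable def substMsq (Q : Polynomial (Polynomial ℂ)) : Polynomial (Polynomial ℂ) :=
  Q.map (Polynomial.aeval (X ^ 2 : Polynomial ℂ)).toRingHom

/-- The image of `S ∈ ℂ[L,M]` under the `ℂ`-algebra homomorphism `L ↦ L`, `M ↦ −M`. -/
noncomputable def substMneg (S : Polynomial (Polynomial ℂ)) : Polynomial (Polynomial ℂ) :=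
  S.map (Polynomial.aeval (-X : Polynomial ℂ)).toRingHom

theorem exists_aeval_X_sq_of_aeval_neg_X {p : ℂ[X]} (hp : aeval (-X : ℂ[X]) p = p) :
    ∃ q : ℂ[X], aeval (X ^ 2 : ℂ[X]) q = p := by
  refine ⟨contract 2 p, ?_⟩
  rw [← expand_aeval, aeval_X_left_apply]
  ext n
  rw [coeff_expand two_pos]
  split_ifs with hn
  · rw [coeff_contract two_ne_zero, Nat.div_mul_cancel hn]
  · have hodd : Odd n := by rwa [← Nat.not_even_iff_odd, even_iff_two_dvd]
    have hc : (p.comp (C (-1) * X)).coeff n = p.coeff n := by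
      simpa [comp_eq_aeval] using congrArg (coeff · n) hp
    rw [comp_C_mul_X_coeff, hodd.neg_one_pow] at hc
    linear_combination (1 / 2 : ℂ) * hc

theorem substMneg_mul (S T : ℂ[X][X]) : substMneg (S * T) = substMneg S * substMneg T :=
  Polynomial.map_mul _

theorem substMneg_substMneg (S : ℂ[X][X]) : substMneg (substMneg S) = S := by
  ext1 n
  simp [substMneg, ← comp_eq_aeval, comp_assoc]

theorem substMneg_substMsq (Q : ℂ[X][X]) : substMneg (substMsq Q) = substMsq Q := by
  ext1 n
  simp [substMneg, substMsq, ← comp_eq_aeval, comp_assoc]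

theorem substMsq_mul (Q R : ℂ[X][X]) : substMsq (Q * R) = substMsq Q * substMsq R :=
  Polynomial.map_mul _

theorem substMsq_one : substMsq 1 = 1 :=
  Polynomial.map_one _

theorem substMsq_injective : Function.Injective substMsq := by
  refine Polynomial.map_injective _ fun p q h => expand_injective two_pos ?_
  simpa [expand_eq_comp_X_pow, ← comp_eq_aeval] using h

theorem exists_substMsq_of_substMneg {S : ℂ[X][X]} (hS : substMneg S = S) :
    ∃ Q, substMsq Q = S := by
  have h : S ∈ lifts (aeval (X ^ 2 : ℂ[X]) : ℂ[X] →ₐ[ℂ] ℂ[X]).toRingHom := by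
    rw [lifts_iff_coeff_lifts]
    intro n
    refine exists_aeval_X_sq_of_aeval_neg_X ?_
    simpa [substMneg] using congrArg (fun T => coeff T n) hS
  exact (mem_lifts S).1 h

theorem exists_substMsq_eq_mul_substMneg (S : ℂ[X][X]) :
    ∃ N, substMsq N = S * substMneg S :=
  exists_substMsq_of_substMneg <| by rw [substMneg_mul, substMneg_substMneg, mul_comm]

theorem isUnit_substMsq_iff {Q : ℂ[X][X]} : IsUnit (substMsq Q) ↔ IsUnit Q := by
  refine ⟨fun h => ?_, fun h => h.map (mapRingHom
    (aeval (X ^ 2 : ℂ[X]) : ℂ[X] →ₐ[ℂ] ℂ[X]).toRingHom)⟩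
  obtain ⟨V, hV⟩ := h.exists_right_inv
  obtain ⟨R, rfl⟩ : ∃ R, substMsq R = V := by
    refine exists_substMsq_of_substMneg (h.mul_left_cancel ?_)
    rw [hV, ← substMneg_substMsq Q, ← substMneg_mul, hV]
    exact Polynomial.map_one _
  rw [← substMsq_mul, ← substMsq_one] at hV
  exact IsUnit.of_mul_eq_one _ (substMsq_injective hV)

/-- If `Q ∈ ℂ[L,M]` is irreducible and `Q(L,M²)` is not irreducible, then
`Q(L,M²) = c·S(L,M)·S(L,−M)` for some `S ∈ ℂ[L,M]` and nonzero `c ∈ ℂ`. -/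
theorem not_irreducible_subst_sq (Q : Polynomial (Polynomial ℂ)) (hQ : Irreducible Q)
    (h : ¬ Irreducible (substMsq Q)) :
    ∃ (S : Polynomial (Polynomial ℂ)) (c : ℂ), c ≠ 0 ∧
      substMsq Q = C (C c) * S * substMneg S := by
  have hu : ¬ IsUnit (substMsq Q) := fun hu => hQ.not_isUnit (isUnit_substMsq_iff.1 hu)
  obtain ⟨A, B, hAB, hA, hB⟩ : ∃ A B, substMsq Q = A * B ∧ ¬ IsUnit A ∧ ¬ IsUnit B := by
    simpa [irreducible_iff, hu] using h
  obtain ⟨a, ha⟩ := exists_substMsq_eq_mul_substMneg A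
  obtain ⟨b, hb⟩ := exists_substMsq_eq_mul_substMneg B
  have ha' : ¬ IsUnit a := fun hu =>
    hA (isUnit_of_mul_isUnit_left (ha ▸ isUnit_substMsq_iff.2 hu))
  have hb' : ¬ IsUnit b := fun hu =>
    hB (isUnit_of_mul_isUnit_left (hb ▸ isUnit_substMsq_iff.2 hu))
  have hab : a * b = Q * Q := substMsq_injective <| by
    rw [substMsq_mul, substMsq_mul, ha, hb]
    nth_rewrite 2 [← substMneg_substMsq Q]
    rw [hAB, substMneg_mul]
    ring
  obtain ⟨i, hi, hai⟩ := (dvd_prime_pow hQ.prime 2).1 (Dvd.intro b (hab.trans (sq Q).symm))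
  have hassoc : Associated a Q := by
    interval_cases i
    · exact absurd (associated_one_iff_isUnit.1 (by simpa using hai)) ha'
    · simpa using hai
    · obtain ⟨u, hu⟩ := hai
      refine absurd (IsUnit.of_mul_eq_one (↑u⁻¹ : ℂ[X][X]) ?_) hb'
      have ha0 : a ≠ 0 := by
        rintro rfl
        exact hQ.ne_zero (by simpa using hab.symm)
      have hbu : b = u := mul_left_cancel₀ ha0 (by rw [hab, hu, sq])
      rw [hbu, Units.mul_inv]
  obtain ⟨u, hu⟩ := hassoc
  obtain ⟨r, hr, hru⟩ := Polynomial.isUnit_iff.1 u.isUnit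
  obtain ⟨c, hc, rfl⟩ := Polynomial.isUnit_iff.1 hr
  refine ⟨A, c, hc.ne_zero, ?_⟩
  rw [← hu, substMsq_mul, ha, ← hru]
  simp only [substMsq, map_C, AlgHom.toRingHom_eq_coe, RingHom.coe_coe, aeval_C, algebraMap_eq]
  ring
end
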